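/- arXiv:1506.01749 — 2 statements merged into one kernel-verified Lean document; each statement's English description precedes it below -/
import Mathlib

section
/- There exists a constant c > 0 such that every connected finite graph with at least one edge and with b branches has metric dimension at most c·b. -/
open SimpleGraph

variable {V : Type*}

/-- A walk is *branch-like* if it is a path or a cycle and every internal vertex
(vertex other than the endpoints) has degree two in `G`. -/
def IsBranchLike (G : SimpleGraph V) {u v : V} (W : G.Walk u v) : Prop :=
  (W.IsPath ∨ ∃ h : v = u, (W.copy rfl h).IsCycle) ∧
  ∀ x ∈ W.support, x ≠ u → x ≠ v → (G.neighborSet x).ncard = 2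

/-- A *branch* of `G` is a maximal branch-like walk (maximal with respect to
containment of edges). -/
def IsBranch (G : SimpleGraph V) {u v : V} (W : G.Walk u v) : Prop :=
  IsBranchLike G W ∧
  ∀ (u' v' : V) (W' : G.Walk u' v'), IsBranchLike G W' →
    (∀ e ∈ W.edges, e ∈ W'.edges) → (∀ e ∈ W'.edges, e ∈ W.edges)

/-- The branches of `G`, identified by their edge sets. -/
def branchSet (G : SimpleGraph V) : Set (Set (Sym2 V)) :=
  {E | ∃ (u v : V) (W : G.Walk u v), IsBranch G W ∧ E = {e | e ∈ W.edges}}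

/-- The number of branches of `G`. -/
noncomputable def branchCount (G : SimpleGraph V) : ℕ := (branchSet G).ncard

/-- The number of leaves (degree-one vertices) of a graph. -/
noncomputable def leafCount (T : SimpleGraph V) : ℕ :=
  {v : V | (T.neighborSet v).ncard = 1}.ncard

/-- The max leaf number of `G`: the maximum number of leaves over all spanning
trees of `G`. -/
noncomputable def maxLeafNumber (G : SimpleGraph V) : ℕ :=
  sSup {k | ∃ T : SimpleGraph V, T ≤ G ∧ T.IsTree ∧ k = leafCount T}

/-- The indistinct set for a vertex `s` and two branches `A`, `B`: pairs of
distinct vertices, one from each branch, that `s` fails to distinguish. -/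
def indistinctSet (G : SimpleGraph V) (s : V) {a₁ a₂ b₁ b₂ : V}
    (A : G.Walk a₁ a₂) (B : G.Walk b₁ b₂) : Set (V × V) :=
  {p : V × V | p.1 ∈ A.support ∧ p.2 ∈ B.support ∧ p.1 ≠ p.2 ∧
    G.dist s p.1 = G.dist s p.2}

/-- A locating set for `G`. -/
def IsLocatingSet (G : SimpleGraph V) (S : Set V) : Prop :=
  ∀ u v : V, u ≠ v → ∃ w ∈ S, G.dist u w ≠ G.dist v w

/-- The metric dimension of `G`: minimum cardinality of a locating set. -/
noncomputable def metricDim (G : SimpleGraph V) : ℕ :=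
  sInf {k | ∃ S : Set V, IsLocatingSet G S ∧ S.ncard = k}

/-- A degree-two vertex has no neighbors besides any two distinct known ones. -/
lemma eq_or_eq_of_ncard_neighborSet_eq_two {G : SimpleGraph V} {a x y z : V}
    (h : (G.neighborSet a).ncard = 2) (hx : G.Adj a x) (hy : G.Adj a y) (hxy : x ≠ y)
    (hz : G.Adj a z) : z = x ∨ z = y := by
  obtain ⟨b, c, -, hbc⟩ := Set.ncard_eq_two.mp h
  have key : ∀ w, G.Adj a w → w = b ∨ w = c := fun w hw => by
    have : w ∈ G.neighborSet a := hw
    simpa [hbc] using this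
  grind

/-- A geodesic `p 0, …, p l` of degree-two vertices that meets `S` exactly in its two ends. -/
structure IsPiece (G : SimpleGraph V) (S : Set V) (p : ℕ → V) (l : ℕ) : Prop where
  adj : ∀ s < l, G.Adj (p s) (p (s + 1))
  dist_ends : G.dist (p 0) (p l) = l
  notMem : ∀ s, 0 < s → s < l → p s ∉ S
  degree : ∀ s ≤ l, (G.neighborSet (p s)).ncard = 2
  left_mem : p 0 ∈ S
  right_mem : p l ∈ S

lemma dist_le_of_adj_succ {G : SimpleGraph V} (hG : G.Connected) {p : ℕ → V} {i : ℕ} :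
    ∀ j, i ≤ j → (∀ s, i ≤ s → s < j → G.Adj (p s) (p (s + 1))) →
      G.dist (p i) (p j) ≤ j - i := by
  intro j hij
  induction j, hij using Nat.le_induction with
  | base => simp
  | succ j hij ih =>
    intro h
    have h1 := ih fun s h1 h2 => h s h1 (by omega)
    have h2 := SimpleGraph.dist_eq_one_iff_adj.mpr (h j hij (by omega))
    have h3 := hG.dist_triangle (u := p i) (v := p j) (w := p (j + 1))
    omega

namespace IsPiece

variable {G : SimpleGraph V} {S : Set V} {p q : ℕ → V} {l n t : ℕ}

lemma dist_eq (hG : G.Connected) (h : IsPiece G S p l) {i j : ℕ} (hij : i ≤ j) (hj : j ≤ l) :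
    G.dist (p i) (p j) = j - i := by
  have h1 := dist_le_of_adj_succ hG i (Nat.zero_le i) fun s _ hs => h.adj s (by omega)
  have h2 := dist_le_of_adj_succ hG j hij fun s _ hs => h.adj s (by omega)
  have h3 := dist_le_of_adj_succ hG l hj fun s _ hs => h.adj s (by omega)
  have h4 := hG.dist_triangle (u := p 0) (v := p i) (w := p l)
  have h5 := hG.dist_triangle (u := p i) (v := p j) (w := p l)
  have h6 := h.dist_ends
  omega

lemma ne (hG : G.Connected) (h : IsPiece G S p l) {i j : ℕ} (hij : i < j) (hj : j ≤ l) :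
    p i ≠ p j := by
  intro e
  have := h.dist_eq hG hij.le hj
  rw [e, SimpleGraph.dist_self] at this
  omega

lemma reverse (h : IsPiece G S p l) : IsPiece G S (fun s => p (l - s)) l where
  adj s hs := by
    have := (h.adj (l - (s + 1)) (by omega)).symm
    rwa [show l - (s + 1) + 1 = l - s by omega] at this
  dist_ends := by
    simpa [SimpleGraph.dist_comm] using h.dist_ends
  notMem s h1 h2 := h.notMem _ (by omega) (by omega)
  degree s _ := h.degree _ (by omega)
  left_mem := by simpa using h.right_mem
  right_mem := by simpa using h.left_mem

lemma eq_of_adj (hG : G.Connected) (h : IsPiece G S p l) (h0 : 0 < t) (hl : t < l) {y : V}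
    (hy : G.Adj (p t) y) : y = p (t - 1) ∨ y = p (t + 1) := by
  refine eq_or_eq_of_ncard_neighborSet_eq_two (h.degree t hl.le) ?_ (h.adj t hl)
    (h.ne hG (by omega) (by omega)) hy
  have := (h.adj (t - 1) (by omega)).symm
  rwa [Nat.sub_add_cancel h0] at this

/-- Walks from a piece to a vertex of `S` pass through one of the ends of the piece. -/
lemma le_length (hG : G.Connected) (h : IsPiece G S p l) {x y : V} (hx : x ∈ S)
    (w : G.Walk y x) : ∀ t ≤ l, y = p t →
      t + G.dist (p 0) x ≤ w.length ∨ l - t + G.dist (p l) x ≤ w.length := by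
  induction w with
  | nil =>
    rintro t ht rfl
    have h0 : t = 0 ∨ t = l := by
      by_contra hc
      exact h.notMem t (by omega) (by omega) hx
    rcases h0 with rfl | rfl <;> simp
  | cons hadj w ih =>
    rintro t ht rfl
    by_cases h0 : t = 0
    · subst h0
      have := SimpleGraph.dist_le (Walk.cons hadj w)
      omega
    by_cases hl : t = l
    · subst hl
      have := SimpleGraph.dist_le (Walk.cons hadj w)
      omega
    rw [Walk.length_cons]
    rcases h.eq_of_adj hG (by omega) (by omega) hadj with e | e
    · have := ih hx (t - 1) (by omega) e
      omega
    · have := ih hx (t + 1) (by omega) e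
      omega

lemma le_dist (hG : G.Connected) (h : IsPiece G S p l) {x : V} (hx : x ∈ S) (ht : t ≤ l) :
    t + G.dist (p 0) x ≤ G.dist (p t) x ∨ l - t + G.dist (p l) x ≤ G.dist (p t) x := by
  obtain ⟨w, hw⟩ := hG.exists_walk_length_eq_dist (p t) x
  have := h.le_length hG hx w t ht rfl
  rwa [hw] at this

/-- A piece is determined by its first two vertices and its length. -/
lemma eq_of_eq_one (hG : G.Connected) (hp : IsPiece G S p l) (hq : IsPiece G S q l)
    (h0 : p 0 = q 0) (h1 : p 1 = q 1) : ∀ t, t < l → p t = q t ∧ p (t + 1) = q (t + 1) := by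
  intro t
  induction t with
  | zero => exact fun _ => ⟨h0, h1⟩
  | succ t ih =>
    intro ht
    obtain ⟨e1, e2⟩ := ih (by omega)
    refine ⟨e2, ?_⟩
    have hadj := hp.adj (t + 1) ht
    rw [e2] at hadj
    rcases hq.eq_of_adj hG (by omega) ht hadj with e | e
    · exact absurd (e1.trans e.symm) (hp.ne hG (by omega) (by omega))
    · exact e

/-- If two pieces have the same ends but different vertices in some position, their union is
the whole graph, so `S` has no two adjacent vertices. -/
lemma eq_of_ends_eq (hG : G.Connected) (hS : ∃ x ∈ S, ∃ y ∈ S, G.Adj x y)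
    (hp : IsPiece G S p l) (hq : IsPiece G S q l) (h0 : p 0 = q 0) (hl : p l = q l)
    (ht0 : 0 < t) (htl : t < l) : p t = q t := by
  by_contra hne
  have hfirst : p 1 ≠ q 1 := fun h1 => hne (hp.eq_of_eq_one hG hq h0 h1 t htl).1
  have hlast : p (l - 1) ≠ q (l - 1) := fun h1 => hne <| by
    have := (hp.reverse.eq_of_eq_one hG hq.reverse (by simpa using hl) h1 (l - t) (by omega)).1
    simpa [Nat.sub_sub_self htl.le] using this
  have hpl := (hp.adj (l - 1) (by omega)).symm
  have hql := (hq.adj (l - 1) (by omega)).symm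
  rw [Nat.sub_add_cancel (by omega)] at hpl hql
  have closed : ∀ x y, G.Adj x y → (∃ s ≤ l, x = p s ∨ x = q s) →
      ∃ s ≤ l, y = p s ∨ y = q s := by
    rintro x y hxy ⟨s, hs, hx⟩
    rcases Nat.eq_zero_or_pos s with rfl | hs0
    · have hx0 : x = p 0 := by grind
      subst hx0
      have := eq_or_eq_of_ncard_neighborSet_eq_two (hp.degree 0 (by omega))
        (hp.adj 0 (by omega)) (h0 ▸ hq.adj 0 (by omega)) hfirst hxy
      exact ⟨1, by omega, this⟩
    rcases hs.eq_or_lt with rfl | hsl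
    · have hx0 : x = p s := by grind
      subst hx0
      have := eq_or_eq_of_ncard_neighborSet_eq_two (hp.degree s (by omega))
        hpl (hl ▸ hql) hlast hxy
      exact ⟨s - 1, by omega, this⟩
    rcases hx with rfl | rfl
    · rcases hp.eq_of_adj hG hs0 hsl hxy with e | e
      · exact ⟨s - 1, by omega, Or.inl e⟩
      · exact ⟨s + 1, by omega, Or.inl e⟩
    · rcases hq.eq_of_adj hG hs0 hsl hxy with e | e
      · exact ⟨s - 1, by omega, Or.inr e⟩
      · exact ⟨s + 1, by omega, Or.inr e⟩
  have cover : ∀ x, ∃ s ≤ l, x = p s ∨ x = q s := by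
    intro x
    obtain ⟨w⟩ := hG.preconnected (p 0) x
    have walk_closed : ∀ {a b : V}, G.Walk a b → (∃ s ≤ l, a = p s ∨ a = q s) →
        ∃ s ≤ l, b = p s ∨ b = q s := by
      intro a b w
      induction w with
      | nil => exact id
      | cons hadj _ ih => exact fun ha => ih (closed _ _ hadj ha)
    exact walk_closed w ⟨0, by omega, Or.inl rfl⟩
  have ends : ∀ x ∈ S, x = p 0 ∨ x = p l := by
    intro x hx
    obtain ⟨s, hs, hxs⟩ := cover x
    have hs' : s = 0 ∨ s = l := by
      by_contra hc
      rcases hxs with rfl | rfl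
      · exact hp.notMem s (by omega) (by omega) hx
      · exact hq.notMem s (by omega) (by omega) hx
    grind
  have hnadj : ¬ G.Adj (p 0) (p l) := by
    rw [← SimpleGraph.dist_eq_one_iff_adj, hp.dist_ends]
    omega
  obtain ⟨x, hx, y, hy, hxy⟩ := hS
  rcases ends x hx with rfl | rfl <;> rcases ends y hy with rfl | rfl
  · exact hxy.ne rfl
  · exact hnadj hxy
  · exact hnadj hxy.symm
  · exact hxy.ne rfl

/-- Vertices of pieces with the same distances to all of `S` are equal. -/
lemma eq_of_dist_eq (hG : G.Connected) (hS : ∃ x ∈ S, ∃ y ∈ S, G.Adj x y)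
    (hp : IsPiece G S p l) (hq : IsPiece G S q n) (ht0 : 0 < t) (htl : t < l)
    {r : ℕ} (hr0 : 0 < r) (hrn : r < n)
    (h : ∀ w ∈ S, G.dist (p t) w = G.dist (q r) w) : p t = q r := by
  have a1 := hp.dist_eq hG (Nat.zero_le t) htl.le
  have a2 := hp.dist_eq hG htl.le le_rfl
  have a3 := hq.dist_eq hG (Nat.zero_le r) hrn.le
  have a4 := hq.dist_eq hG hrn.le le_rfl
  rw [SimpleGraph.dist_comm] at a1 a3
  have b1 := hq.le_dist hG hp.left_mem hrn.le
  have b2 := hq.le_dist hG hp.right_mem hrn.le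
  have b3 := hp.le_dist hG hq.left_mem htl.le
  have b4 := hp.le_dist hG hq.right_mem htl.le
  rw [← h _ hp.left_mem] at b1
  rw [← h _ hp.right_mem] at b2
  rw [h _ hq.left_mem] at b3
  rw [h _ hq.right_mem] at b4
  have c1 := hG.dist_triangle (u := p 0) (v := q 0) (w := p l)
  have c2 := hG.dist_triangle (u := p 0) (v := q n) (w := p l)
  have c3 := hG.dist_triangle (u := q 0) (v := p 0) (w := q n)
  have c4 := hG.dist_triangle (u := q 0) (v := p l) (w := q n)
  have d1 := hp.dist_ends
  have d2 := hq.dist_ends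
  rw [SimpleGraph.dist_comm (u := q 0) (v := p 0)] at *
  rw [SimpleGraph.dist_comm (u := q 0) (v := p l)] at *
  rw [SimpleGraph.dist_comm (u := q n) (v := p 0)] at *
  rw [SimpleGraph.dist_comm (u := q n) (v := p l)] at *
  have key : (G.dist (p 0) (q 0) = 0 ∧ G.dist (p l) (q n) = 0 ∧ l = n ∧ t = r) ∨
      (G.dist (p 0) (q n) = 0 ∧ G.dist (p l) (q 0) = 0 ∧ l = n ∧ t = n - r) := by
    omega
  rcases key with ⟨e1, e2, rfl, rfl⟩ | ⟨e1, e2, rfl, e4⟩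
  · exact hp.eq_of_ends_eq hG hS hq (hG.dist_eq_zero_iff.mp e1) (hG.dist_eq_zero_iff.mp e2)
      ht0 htl
  · have := hp.eq_of_ends_eq hG hS hq.reverse (by simpa using hG.dist_eq_zero_iff.mp e1)
      (by simpa using hG.dist_eq_zero_iff.mp e2) ht0 htl
    simpa [e4, Nat.sub_sub_self hrn.le] using this

end IsPiece

/-- If every vertex outside `S` is interior to a piece, then `S` is locating. -/
lemma isLocatingSet_of_isPiece {G : SimpleGraph V} (hG : G.Connected) {S : Set V}
    (hS : ∃ x ∈ S, ∃ y ∈ S, G.Adj x y)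
    (h : ∀ u ∉ S, ∃ p l t, IsPiece G S p l ∧ 0 < t ∧ t < l ∧ p t = u) :
    IsLocatingSet G S := by
  intro u v huv
  by_contra! hc
  by_cases hu : u ∈ S
  · have := hc u hu
    rw [SimpleGraph.dist_self] at this
    exact huv (hG.dist_eq_zero_iff.mp this.symm).symm
  by_cases hv : v ∈ S
  · have := hc v hv
    rw [SimpleGraph.dist_self] at this
    exact huv (hG.dist_eq_zero_iff.mp this)
  obtain ⟨p, l, t, hp, ht0, htl, rfl⟩ := h u hu
  obtain ⟨q, n, r, hq, hr0, hrn, rfl⟩ := h v hv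
  exact huv (hp.eq_of_dist_eq hG hS hq ht0 htl hr0 hrn hc)

/-- A function that changes by at most one along edges bounds distances from below. -/
lemma le_add_dist {G : SimpleGraph V} (hG : G.Connected) {f : V → ℕ}
    (hf : ∀ x y, G.Adj x y → f x ≤ f y + 1) (x y : V) : f x ≤ f y + G.dist x y := by
  obtain ⟨w, hw⟩ := hG.exists_walk_length_eq_dist x y
  rw [← hw]
  clear hw
  induction w with
  | nil => simp
  | cons hadj w ih =>
    have := hf _ _ hadj
    rw [Walk.length_cons]
    omega

namespace IsBranchLike

variable {G : SimpleGraph V} {u v : V} {W : G.Walk u v}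

lemma isTrail (h : IsBranchLike G W) : W.IsTrail := by
  rcases h.1 with hp | ⟨rfl, hc⟩
  · exact hp.isTrail
  · exact hc.isTrail

lemma getVert_inj (h : IsBranchLike G W) {s s' : ℕ} (h0 : 0 < s) (hk : s < W.length)
    (hs' : s' ≤ W.length) (e : W.getVert s = W.getVert s') : s = s' := by
  rcases h.1 with hp | ⟨rfl, hc⟩
  · exact hp.getVert_injOn (by simpa using hk.le) (by simpa using hs') e
  · rw [Walk.copy_rfl_rfl] at hc
    rcases Nat.eq_zero_or_pos s' with rfl | h0'
    · exact hc.getVert_injOn' (by simp only [Set.mem_ofPred_eq]; omega) (by simp) e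
    · exact hc.getVert_injOn ⟨h0, hk.le⟩ ⟨h0', hs'⟩ e

lemma ncard_neighborSet (h : IsBranchLike G W) {s : ℕ} (h0 : 0 < s) (hk : s < W.length) :
    (G.neighborSet (W.getVert s)).ncard = 2 := by
  refine h.2 _ (W.getVert_mem_support s) (fun e => ?_) (fun e => ?_)
  · have := h.getVert_inj h0 hk (Nat.zero_le _) (e.trans W.getVert_zero.symm)
    omega
  · have := h.getVert_inj h0 hk le_rfl (e.trans W.getVert_length.symm)
    omega

lemma eq_of_adj (h : IsBranchLike G W) (hW : 3 ≤ W.length) {s : ℕ} (h0 : 0 < s)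
    (hk : s < W.length) {y : V} (hy : G.Adj (W.getVert s) y) :
    y = W.getVert (s - 1) ∨ y = W.getVert (s + 1) := by
  refine eq_or_eq_of_ncard_neighborSet_eq_two (h.ncard_neighborSet h0 hk) ?_
    (W.adj_getVert_succ hk) (fun e => ?_) hy
  · have := (W.adj_getVert_succ (i := s - 1) (by omega)).symm
    rwa [Nat.sub_add_cancel h0] at this
  · rcases Nat.lt_or_ge (s + 1) W.length with h1 | h1
    · have := h.getVert_inj (by omega) h1 (by omega) e.symm
      omega
    · have := h.getVert_inj (s := s - 1) (by omega) (by omega) (by omega) e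
      omega

/-- A function of the position along a branch-like walk that vanishes at both ends and changes
by at most one in each step bounds distances from below. -/
lemma le_add_dist (hG : G.Connected) (h : IsBranchLike G W) (hW : 3 ≤ W.length) {g : ℕ → ℕ}
    (g0 : g 0 = 0) (gk : g W.length = 0) (hg : ∀ s, g s ≤ g (s + 1) + 1 ∧ g (s + 1) ≤ g s + 1)
    {i j : ℕ} (hi : i ≤ W.length) (hj : j ≤ W.length) :
    g i ≤ g j + G.dist (W.getVert i) (W.getVert j) := by
  classical
  let f : V → ℕ := fun x =>
    if hx : ∃ s, 0 < s ∧ s < W.length ∧ W.getVert s = x then g hx.choose else 0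
  have hfg : ∀ s ≤ W.length, f (W.getVert s) = g s := by
    intro s hs
    by_cases hx : ∃ s', 0 < s' ∧ s' < W.length ∧ W.getVert s' = W.getVert s
    · have e : f (W.getVert s) = g hx.choose := dif_pos hx
      obtain ⟨c0, ck, ce⟩ := hx.choose_spec
      rw [e, h.getVert_inj c0 ck hs ce]
    · have e : f (W.getVert s) = 0 := dif_neg hx
      rcases Nat.eq_zero_or_pos s with rfl | h0
      · rw [e, g0]
      rcases hs.eq_or_lt with rfl | hlt
      · rw [e, gk]
      exact absurd ⟨s, h0, hlt, rfl⟩ hx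
  have hf : ∀ x y, G.Adj x y → f x ≤ f y + 1 := by
    intro x y hxy
    by_cases hx : ∃ s, 0 < s ∧ s < W.length ∧ W.getVert s = x
    · obtain ⟨s, h0, hk, rfl⟩ := hx
      rw [hfg s hk.le]
      rcases h.eq_of_adj hW h0 hk hxy with rfl | rfl
      · rw [hfg _ (by omega)]
        have := (hg (s - 1)).2
        rwa [Nat.sub_add_cancel h0] at this
      · rw [hfg _ (by omega)]
        exact (hg s).1
    · have e : f x = 0 := dif_neg hx
      omega
  have := _root_.le_add_dist hG hf (W.getVert i) (W.getVert j)
  rwa [hfg i hi, hfg j hj] at this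

/-- Each half of a branch-like walk, without the end vertices of the walk, is a geodesic. -/
lemma dist_getVert (hG : G.Connected) (h : IsBranchLike G W) (hW : 3 ≤ W.length) {i j : ℕ}
    (h1 : 1 ≤ i) (hij : i ≤ j) (hj : j < W.length)
    (hhalf : j ≤ W.length / 2 ∨ W.length / 2 ≤ i) :
    G.dist (W.getVert i) (W.getVert j) = j - i := by
  refine le_antisymm
    (dist_le_of_adj_succ hG j hij fun s _ hs => W.adj_getVert_succ (by omega)) ?_
  rcases hhalf with hm | hm
  · have := h.le_add_dist hG hW (g := fun t => min (t - 1) (2 * (W.length / 2) - 1 - t))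
      (by simp) (by omega) (fun s => by omega) hj.le (i := j) (j := i)
      (by omega)
    rw [SimpleGraph.dist_comm] at this
    omega
  · have := h.le_add_dist hG hW
      (g := fun t => min (t + (W.length - 1) - 2 * (W.length / 2)) (W.length - 1 - t))
      (by omega) (by omega) (fun s => by omega)
      (i := i) (j := j) (by omega) hj.le
    omega

/-- Between any two marked positions in the same half there is a piece around an unmarked one. -/
lemma exists_isPiece_of_half (hG : G.Connected) (h : IsBranchLike G W) (hW : 3 ≤ W.length)
    {S : Set V} {i j t : ℕ} (h1 : 1 ≤ i) (hj : j < W.length)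
    (hhalf : j ≤ W.length / 2 ∨ W.length / 2 ≤ i) (hit : i ≤ t) (htj : t ≤ j)
    (hiS : W.getVert i ∈ S) (hjS : W.getVert j ∈ S) (ht : W.getVert t ∉ S) :
    ∃ p l t', IsPiece G S p l ∧ 0 < t' ∧ t' < l ∧ p t' = W.getVert t := by
  classical
  have hex : ∃ d, W.getVert (t + d) ∈ S := ⟨j - t, by rwa [Nat.add_sub_cancel' htj]⟩
  have hex' : ∃ d, W.getVert (t - d) ∈ S := ⟨t - i, by rwa [Nat.sub_sub_self hit]⟩
  obtain ⟨b, hb, hbmin⟩ : ∃ d, W.getVert (t + d) ∈ S ∧ ∀ d' < d, W.getVert (t + d') ∉ S :=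
    ⟨Nat.find hex, Nat.find_spec hex, fun _ => Nat.find_min hex⟩
  obtain ⟨a, ha, hamin⟩ : ∃ d, W.getVert (t - d) ∈ S ∧ ∀ d' < d, W.getVert (t - d') ∉ S :=
    ⟨Nat.find hex', Nat.find_spec hex', fun _ => Nat.find_min hex'⟩
  have hbj : b ≤ j - t := by
    by_contra hc
    exact hbmin (j - t) (by omega) (by rwa [Nat.add_sub_cancel' htj])
  have hai : a ≤ t - i := by
    by_contra hc
    exact hamin (t - i) (by omega) (by rwa [Nat.sub_sub_self hit])
  have ha0 : a ≠ 0 := by rintro rfl; exact ht ha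
  have hb0 : b ≠ 0 := by rintro rfl; exact ht hb
  refine ⟨fun s => W.getVert (t - a + s), a + b, a,
    ⟨fun s hs => W.adj_getVert_succ (by omega), ?_, fun s hs0 hs => ?_,
      fun s hs => h.ncard_neighborSet (by omega) (by omega), ha, ?_⟩, by omega, by omega, ?_⟩
  · have := h.dist_getVert hG hW (i := t - a) (j := t - a + (a + b)) (by omega) (by omega)
      (by omega) (by omega)
    rw [Nat.add_zero, this]
    omega
  · rcases Nat.lt_or_ge s a with hsa | hsa
    · rw [show t - a + s = t - (a - s) by omega]
      exact hamin _ (by omega)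
    · rw [show t - a + s = t + (s - a) by omega]
      exact hbmin _ (by omega)
  · rwa [show t - a + (a + b) = t + b by omega]
  · exact congrArg W.getVert (Nat.sub_add_cancel (by omega))

/-- Marking the two vertices at each end and the middle vertex of a branch-like walk puts every
unmarked vertex of the walk inside a piece. -/
lemma exists_isPiece (hG : G.Connected) (h : IsBranchLike G W) {S : Set V}
    (hS : ∀ s ∈ [0, 1, W.length / 2, W.length - 1, W.length], W.getVert s ∈ S)
    {x : V} (hx : x ∈ W.support) (hxS : x ∉ S) :
    ∃ p l t, IsPiece G S p l ∧ 0 < t ∧ t < l ∧ p t = x := by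
  obtain ⟨t, rfl, ht⟩ := Walk.mem_support_iff_exists_getVert.mp hx
  have hne : ∀ s ∈ [0, 1, W.length / 2, W.length - 1, W.length], t ≠ s := by
    rintro s hs rfl
    exact hxS (hS _ hs)
  simp only [List.forall_mem_cons, List.not_mem_nil, false_imp_iff, implies_true, and_true]
    at hne hS
  obtain ⟨n0, n1, nm, nl, nk⟩ := hne
  obtain ⟨-, s1, sm, sl, -⟩ := hS
  rcases Nat.lt_or_gt_of_ne nm with hm | hm
  · exact h.exists_isPiece_of_half hG (by omega) le_rfl (by omega) (Or.inl le_rfl)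
      (by omega) hm.le s1 sm hxS
  · exact h.exists_isPiece_of_half hG (by omega) (by omega) (by omega) (Or.inr le_rfl)
      hm.le (by omega) sm sl hxS

end IsBranchLike

lemma exists_isBranch_of_adj [Fintype V] {G : SimpleGraph V} {x y : V} (hxy : G.Adj x y) :
    ∃ (u v : V) (W : G.Walk u v), IsBranch G W ∧ s(x, y) ∈ W.edges := by
  classical
  let P : ℕ → Prop := fun k => ∃ (u v : V) (W : G.Walk u v),
    IsBranchLike G W ∧ s(x, y) ∈ W.edges ∧ W.length = k
  have hbound : ∀ k, P k → k ≤ G.edgeFinset.card := by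
    rintro k ⟨u, v, W, hW, -, rfl⟩
    exact hW.isTrail.length_le_card_edgeFinset
  have hP : P 1 := by
    refine ⟨x, y, hxy.toWalk, ⟨Or.inl (Walk.IsPath.of_adj hxy), ?_⟩, by simp, by simp⟩
    intro z hz hzx hzy
    simp [hzx, hzy] at hz
  obtain ⟨u, v, W, hW, he, hlen⟩ := Nat.findGreatest_spec (hbound 1 hP) hP
  refine ⟨u, v, W, ⟨hW, fun u' v' W' hW' hsub => ?_⟩, he⟩
  have hlen' : W'.length ≤ W.length := by
    have hP' : P W'.length := ⟨u', v', W', hW', hsub _ he, rfl⟩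
    rw [hlen]
    exact Nat.le_findGreatest (hbound _ hP') hP'
  have hperm := (hW.isTrail.edges_nodup.subperm hsub).perm_of_length_le (by simpa using hlen')
  exact fun e he' => hperm.symm.subset he'

/-- There is a constant `c > 0` such that every connected finite graph with at
least one edge and `b` branches has metric dimension at most `c * b`. -/
theorem metricDim_le_branches :
    ∃ c : ℕ, 0 < c ∧ ∀ (V : Type) [Fintype V] (G : SimpleGraph V),
      G.Connected → G.edgeSet.Nonempty →
      metricDim G ≤ c * branchCount G := by
  refine ⟨5, by norm_num, fun V _ G hG hE => ?_⟩
  classical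
  obtain ⟨e, he⟩ := hE
  induction e with | _ x₀ y₀ =>
  have hnt : Nontrivial V := ⟨x₀, y₀, he.ne⟩
  have hmark : ∀ E ∈ branchSet G, ∃ F : Finset V, F.card ≤ 5 ∧
      ∃ (u v : V) (W : G.Walk u v), IsBranchLike G W ∧ E = {e | e ∈ W.edges} ∧
        ∀ s ∈ [0, 1, W.length / 2, W.length - 1, W.length], W.getVert s ∈ F := by
    rintro E ⟨u, v, W, hW, hEW⟩
    refine ⟨([0, 1, W.length / 2, W.length - 1, W.length].map W.getVert).toFinset,
      (List.toFinset_card_le _).trans (by simp), u, v, W, hW.1, hEW, fun s hs => ?_⟩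
    exact List.mem_toFinset.mpr (List.mem_map_of_mem hs)
  choose! F hF5 hF using hmark
  have hfin : (branchSet G).Finite := Set.toFinite _
  let S : Finset V := hfin.toFinset.biUnion F
  have hcover : ∀ {x y}, G.Adj x y → ∃ (u v : V) (W : G.Walk u v), IsBranchLike G W ∧
      s(x, y) ∈ W.edges ∧
      ∀ s ∈ [0, 1, W.length / 2, W.length - 1, W.length], W.getVert s ∈ (S : Set V) := by
    intro x y hxy
    obtain ⟨u', v', W', hW', hxy'⟩ := exists_isBranch_of_adj hxy
    have hmem : {e | e ∈ W'.edges} ∈ branchSet G := ⟨u', v', W', hW', rfl⟩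
    obtain ⟨u, v, W, hW, hEW, hs⟩ := hF _ hmem
    refine ⟨u, v, W, hW, ?_, fun s hs' => ?_⟩
    · have : s(x, y) ∈ {e | e ∈ W'.edges} := hxy'
      rwa [hEW] at this
    · exact Finset.mem_coe.mpr
        (Finset.mem_biUnion.mpr ⟨_, hfin.mem_toFinset.mpr hmem, hs s hs'⟩)
  have hloc : IsLocatingSet G (S : Set V) := by
    refine isLocatingSet_of_isPiece hG ?_ fun x hx => ?_
    · obtain ⟨u, v, W, -, hmem, hs⟩ := hcover he
      have hpos : 0 < W.length := by
        rw [← Walk.length_edges]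
        exact List.length_pos_of_mem hmem
      exact ⟨_, hs 0 (by simp), _, hs 1 (by simp), W.adj_getVert_succ hpos⟩
    · obtain ⟨y, hxy⟩ := hG.preconnected.exists_adj_of_nontrivial x
      obtain ⟨u, v, W, hW, hmem, hs⟩ := hcover hxy
      exact hW.exists_isPiece hG hs (W.fst_mem_support_of_mem_edges hmem) hx
  calc metricDim G ≤ (S : Set V).ncard := Nat.sInf_le ⟨S, hloc, rfl⟩
    _ = S.card := Set.ncard_coe_finset S
    _ ≤ hfin.toFinset.card * 5 :=
      Finset.card_biUnion_le_card_mul _ _ _ fun E hE => hF5 E (hfin.mem_toFinset.mp hE)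
    _ = 5 * branchCount G := by
      rw [branchCount, Set.ncard_eq_toFinset_card _ hfin, mul_comm]
end

section
/- There exists a constant c > 0 such that every connected finite graph with at least one edge and with max leaf number ℓ has metric dimension at most c·ℓ². -/
open SimpleGraph

variable {V : Type*}

open scoped Classical in
/-- In a finite tree the degree sum of a vertex set `Y` is at most `2 * #Y` plus the number of
leaves. -/
lemma SimpleGraph.IsTree.sum_degree_le [Fintype V] {T : SimpleGraph V} (hT : T.IsTree)
    [Nontrivial V] (Y : Finset V) :
    ∑ v ∈ Y, T.degree v ≤ 2 * Y.card + (Finset.univ.filter fun v ↦ T.degree v = 1).card := by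
  have hsum := T.sum_degrees_eq_twice_card_edges
  have hcard := hT.card_edgeFinset
  rw [← Finset.sum_add_sum_compl Y] at hsum
  have hc := Finset.card_add_card_compl Y
  have hlow : 2 * Yᶜ.card ≤ ∑ v ∈ Yᶜ, T.degree v +
      (Finset.univ.filter fun v ↦ T.degree v = 1).card := by
    have h1 : ∑ v ∈ Yᶜ, (if T.degree v = 1 then 1 else 0) ≤
        (Finset.univ.filter fun v ↦ T.degree v = 1).card := by
      rw [Finset.card_filter]
      exact Finset.sum_le_sum_of_subset (Finset.subset_univ _)
    have h2 : ∑ v ∈ Yᶜ, 2 ≤ ∑ v ∈ Yᶜ, (T.degree v + if T.degree v = 1 then 1 else 0) := by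
      refine Finset.sum_le_sum fun v _ ↦ ?_
      have := hT.connected.preconnected.degree_pos_of_nontrivial v
      split_ifs <;> omega
    rw [Finset.sum_add_distrib, Finset.sum_const, smul_eq_mul] at h2
    omega
  omega

open scoped Classical in
/-- A finite tree has at most twice as many vertices of degree different from two as leaves. -/
lemma SimpleGraph.IsTree.card_degree_ne_two_le [Fintype V] {T : SimpleGraph V} (hT : T.IsTree)
    [Nontrivial V] :
    (Finset.univ.filter fun v ↦ T.degree v ≠ 2).card ≤
      2 * (Finset.univ.filter fun v ↦ T.degree v = 1).card := by
  have h := hT.sum_degree_le (Finset.univ.filter fun v ↦ 3 ≤ T.degree v)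
  have h3 : (Finset.univ.filter fun v ↦ 3 ≤ T.degree v).card * 3 ≤
      ∑ v ∈ Finset.univ.filter fun v ↦ 3 ≤ T.degree v, T.degree v := by
    rw [← smul_eq_mul]
    exact Finset.card_nsmul_le_sum _ _ _ fun v hv ↦ (Finset.mem_filter.1 hv).2
  have hsub : (Finset.univ.filter fun v ↦ T.degree v ≠ 2) ⊆
      (Finset.univ.filter fun v ↦ 3 ≤ T.degree v) ∪
        (Finset.univ.filter fun v ↦ T.degree v = 1) := by
    intro v hv
    have := hT.connected.preconnected.degree_pos_of_nontrivial v
    simp only [Finset.mem_filter, Finset.mem_union, Finset.mem_univ, true_and] at hv ⊢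
    omega
  have := (Finset.card_le_card hsub).trans (Finset.card_union_le _ _)
  omega

open scoped Classical in
lemma SimpleGraph.IsTree.card_union_neighbors_le [Fintype V] {T : SimpleGraph V} (hT : T.IsTree)
    [Nontrivial V] (Y : Finset V) :
    (Y ∪ Y.biUnion fun v ↦ T.neighborFinset v).card ≤
      3 * Y.card + (Finset.univ.filter fun v ↦ T.degree v = 1).card := by
  have h1 := Finset.card_union_le Y (Y.biUnion fun v ↦ T.neighborFinset v)
  have h2 : (Y.biUnion fun v ↦ T.neighborFinset v).card ≤ ∑ v ∈ Y, T.degree v := Finset.card_biUnion_le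
  have h3 := hT.sum_degree_le Y
  omega

lemma leafCount_eq [Fintype V] (T : SimpleGraph V) [DecidableRel T.Adj] :
    leafCount T = (Finset.univ.filter fun v ↦ T.degree v = 1).card := by
  rw [leafCount, ← Set.ncard_coe_finset]
  congr 1
  ext v
  simp [Set.ncard_eq_toFinset_card', ← neighborFinset_eq_filter]

lemma SimpleGraph.degree_eq_two_neighbors {G : SimpleGraph V} {a b : V}
    [Fintype (G.neighborSet a)] (h : G.degree a = 2) (hab : G.Adj a b) :
    ∃ c, c ≠ b ∧ ∀ x, G.Adj a x ↔ x = b ∨ x = c := by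
  classical
  obtain ⟨x, y, hxy, hN⟩ := Finset.card_eq_two.1 h
  have hmem : ∀ z, G.Adj a z ↔ z = x ∨ z = y := fun z ↦ by
    rw [← G.mem_neighborFinset, hN]; simp
  rcases (hmem b).1 hab with rfl | rfl
  · exact ⟨y, hxy.symm, hmem⟩
  · exact ⟨x, hxy, fun z ↦ (hmem z).trans or_comm⟩

lemma bddAbove_leafCount [Fintype V] (G : SimpleGraph V) :
    BddAbove {k | ∃ T : SimpleGraph V, T ≤ G ∧ T.IsTree ∧ k = leafCount T} := by
  classical
  refine ⟨Fintype.card V, ?_⟩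
  rintro _ ⟨T, -, -, rfl⟩
  rw [leafCount_eq]
  exact Finset.card_le_univ _

lemma SimpleGraph.Connected.exists_isTree_leafCount_eq [Fintype V] {G : SimpleGraph V}
    (hG : G.Connected) : ∃ T ≤ G, T.IsTree ∧ leafCount T = maxLeafNumber G := by
  obtain ⟨T₀, hle, hT₀⟩ := hG.exists_isTree_le
  have hne : {k | ∃ T : SimpleGraph V, T ≤ G ∧ T.IsTree ∧ k = leafCount T}.Nonempty :=
    ⟨_, T₀, hle, hT₀, rfl⟩
  obtain ⟨T, hTG, hT, h⟩ := Nat.sSup_mem hne (bddAbove_leafCount G)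
  exact ⟨T, hTG, hT, h.symm⟩

/-- Connected spanning subgraphs have no more leaves than the best spanning tree. -/
lemma SimpleGraph.Connected.leafCount_le_maxLeafNumber [Fintype V] [Nontrivial V]
    {G H : SimpleGraph V} (hH : H.Connected) (hHG : H ≤ G) :
    leafCount H ≤ maxLeafNumber G := by
  classical
  obtain ⟨T, hle, hT⟩ := hH.exists_isTree_le
  refine le_trans ?_ (le_csSup (bddAbove_leafCount G) ⟨T, hle.trans hHG, hT, rfl⟩)
  rw [leafCount_eq, leafCount_eq]
  refine Finset.card_le_card fun v hv ↦ ?_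
  simp only [Finset.mem_filter, Finset.mem_univ, true_and] at hv ⊢
  have h1 := hT.connected.preconnected.degree_pos_of_nontrivial v
  have h2 : T.degree v ≤ H.degree v := degree_le_of_le hle
  omega

/-- If a non-tree edge `uv` of `G` starts at a vertex `u` such that every vertex within tree
distance two of `u` has tree degree two, then some connected spanning subgraph of `G` has more
leaves than the tree. -/
lemma SimpleGraph.IsTree.exists_connected_leafCount_lt [Fintype V] [DecidableEq V]
    {G T : SimpleGraph V} [DecidableRel T.Adj] (hT : T.IsTree) (hTG : T ≤ G) {u v : V}
    (huv : G.Adj u v) (hnuv : ¬ T.Adj u v) (hu : T.degree u = 2)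
    (hu₁ : ∀ y, T.Adj u y → T.degree y = 2)
    (hu₂ : ∀ y z, T.Adj u y → T.Adj y z → T.degree z = 2) :
    ∃ H ≤ G, H.Connected ∧ leafCount T < leafCount H := by
  obtain ⟨p, hp, -⟩ := hT.existsUnique_path u v
  match p, hp with
  | .nil, _ => exact absurd huv G.irrefl
  | .cons h .nil, _ => exact absurd h hnuv
  | .cons (v := y) huy (.cons (v := z) hyz q), hp =>
    rw [Walk.cons_isPath_iff, Walk.cons_isPath_iff] at hp
    obtain ⟨⟨-, hyq⟩, huq⟩ := hp
    have hyv : y ≠ v := fun h ↦ hyq (h ▸ q.end_mem_support)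
    have huz : u ≠ z := fun h ↦ huq (by simp [h])
    obtain ⟨H, hadj⟩ : ∃ H : SimpleGraph V, ∀ a b, H.Adj a b ↔
        (T.Adj a b ∧ ¬ (a = y ∧ b = z ∨ a = z ∧ b = y)) ∨
          (a = u ∧ b = v ∨ a = v ∧ b = u) := by
      refine ⟨T.deleteEdges {s(y, z)} ⊔ edge u v, fun a b ↦ ?_⟩
      simp only [sup_adj, deleteEdges_adj, Set.mem_singleton_iff, Sym2.eq_iff, edge_adj]
      have := huv.ne
      grind
    have hzv : H.Reachable z v := by
      refine ⟨q.transfer H fun e he ↦ ?_⟩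
      induction e with | _ a b
      rw [mem_edgeSet, hadj]
      refine Or.inl ⟨q.adj_of_mem_edges he, ?_⟩
      have ha := q.fst_mem_support_of_mem_edges he
      have hb := q.snd_mem_support_of_mem_edges he
      rintro (⟨rfl, -⟩ | ⟨-, rfl⟩) <;> contradiction
    have hvu : H.Reachable v u := Adj.reachable ((hadj v u).2 (by simp))
    have huy' : H.Reachable u y := Adj.reachable ((hadj u y).2 (.inl ⟨huy, by
      have := huy.ne; tauto⟩))
    have hzy : H.Reachable z y := hzv.trans (hvu.trans huy')
    refine ⟨H, ?_, ?_, ?_⟩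
    · intro a b hab
      rcases (hadj a b).1 hab with h | ⟨rfl, rfl⟩ | ⟨rfl, rfl⟩
      · exact hTG h.1
      · exact huv
      · exact huv.symm
    · have hstep : ∀ a b, T.Adj a b → H.Reachable a b := by
        intro a b hab
        by_cases h : a = y ∧ b = z ∨ a = z ∧ b = y
        · rcases h with ⟨rfl, rfl⟩ | ⟨rfl, rfl⟩
          · exact hzy.symm
          · exact hzy
        · exact Adj.reachable ((hadj a b).2 (.inl ⟨hab, h⟩))
      have := hT.connected.nonempty
      refine ⟨fun a b ↦ ?_⟩
      obtain ⟨w⟩ := hT.connected a b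
      induction w with
      | nil => exact .rfl
      | cons h _ ih => exact (hstep _ _ h).trans ih
    · have : DecidableRel H.Adj := Classical.decRel _
      rw [leafCount_eq, leafCount_eq]
      have hy : H.degree y = 1 := by
        rw [degree_eq_one_iff_existsUnique_adj]
        obtain ⟨c, hc, hN⟩ := degree_eq_two_neighbors (hu₁ y huy) hyz
        refine ⟨u, (hadj _ _).2 (.inl ⟨huy.symm, by grind⟩), fun x hx ↦ ?_⟩
        have := (hN u).1 huy.symm
        have := huy.ne
        grind
      have hz : z ≠ v → H.degree z = 1 := by
        intro hzv
        rw [degree_eq_one_iff_existsUnique_adj]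
        obtain ⟨c, hc, hN⟩ := degree_eq_two_neighbors (hu₂ y z huy hyz) hyz.symm
        refine ⟨c, (hadj _ _).2 (.inl ⟨(hN c).2 (.inr rfl), by
          have := hyz.ne; tauto⟩), fun x hx ↦ ?_⟩
        grind
      have hdz := hu₂ y z huy hyz
      have hdy := hu₁ y huy
      have hold : ∀ w, w ≠ v → T.degree w = 1 → H.degree w = 1 := by
        intro w hwv hw
        have hwu : w ≠ u := by rintro rfl; omega
        have hwy : w ≠ y := by rintro rfl; omega
        have hwz : w ≠ z := by rintro rfl; omega
        rw [degree_eq_one_iff_existsUnique_adj] at hw ⊢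
        have : ∀ x, H.Adj w x ↔ T.Adj w x := fun x ↦ by rw [hadj]; tauto
        simpa only [this] using hw
      by_cases hzv : z = v
      · subst hzv
        refine Finset.card_lt_card ⟨fun w hw ↦ ?_, fun h ↦ ?_⟩
        · simp only [Finset.mem_filter, Finset.mem_univ, true_and] at hw ⊢
          exact hold w (by rintro rfl; omega) hw
        · have := @h y (by simpa using hy)
          simp only [Finset.mem_filter, Finset.mem_univ, true_and] at this
          omega
      · set L := Finset.univ.filter fun w ↦ T.degree w = 1 with hL
        have hsub : insert y (insert z (L.erase v)) ⊆
            Finset.univ.filter fun w ↦ H.degree w = 1 := by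
          intro w hw
          simp only [Finset.mem_insert, Finset.mem_erase, hL, Finset.mem_filter,
            Finset.mem_univ, true_and] at hw ⊢
          rcases hw with rfl | rfl | ⟨h, h'⟩
          exacts [hy, hz hzv, hold _ h h']
        have hcard := Finset.card_le_card hsub
        rw [Finset.card_insert_of_notMem (by simp [hL, hdy, hyz.ne]),
          Finset.card_insert_of_notMem (by simp [hL, hdz])] at hcard
        have := Finset.pred_card_le_card_erase (s := L) (a := v)
        omega

/-- Distances from a path whose interior vertices have no neighbours off the path. -/
lemma SimpleGraph.Connected.le_dist_of_path {G : SimpleGraph V} (hG : G.Connected) {P : ℕ → V}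
    {L : ℕ} (hN : ∀ j, 0 < j → j < L → ∀ w, G.Adj (P j) w → w = P (j - 1) ∨ w = P (j + 1))
    {v : V} (hv : ∀ j, 0 < j → j < L → v ≠ P j) {j : ℕ} (hj : j ≤ L) :
    j + G.dist (P 0) v ≤ G.dist (P j) v ∨ L - j + G.dist (P L) v ≤ G.dist (P j) v := by
  obtain ⟨p, hp⟩ := hG.exists_walk_length_eq_dist (P j) v
  rw [← hp]
  clear hp
  suffices H : ∀ n j, j ≤ L → ∀ p : G.Walk (P j) v, p.length = n →
      j + G.dist (P 0) v ≤ n ∨ L - j + G.dist (P L) v ≤ n from H _ j hj p rfl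
  intro n
  induction n with
  | zero =>
    intro j hj p hp
    have hjv := Walk.eq_of_length_eq_zero hp
    rcases Nat.eq_zero_or_pos j with rfl | h0
    · simp [hjv]
    rcases hj.eq_or_lt with rfl | hlt
    · simp [hjv]
    exact absurd hjv.symm (hv j h0 hlt)
  | succ n ih =>
    intro j hj p hp
    rcases Nat.eq_zero_or_pos j with rfl | h0
    · have := G.dist_le p
      omega
    rcases hj.eq_or_lt with rfl | hlt
    · have := G.dist_le p
      omega
    obtain ⟨w, h, q, rfl⟩ := Walk.exists_eq_cons_of_ne
      (fun h ↦ hv j h0 hlt h.symm) p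
    · rw [Walk.length_cons] at hp
      rcases hN j h0 hlt _ h with rfl | rfl
      · have := ih (j - 1) (by omega) q (by omega)
        omega
      · have := ih (j + 1) (by omega) q (by omega)
        omega

lemma SimpleGraph.Connected.dist_le_of_chain {G : SimpleGraph V} (hG : G.Connected) {P : ℕ → V}
    {L : ℕ} (hadj : ∀ j < L, G.Adj (P j) (P (j + 1))) {i j : ℕ} (hij : i ≤ j) (hj : j ≤ L) :
    G.dist (P i) (P j) ≤ j - i := by
  induction j, hij using Nat.le_induction with
  | base => simp
  | succ j hij ih =>
    have h1 := ih (by omega)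
    have h2 := dist_eq_one_iff_adj.2 (hadj j (by omega))
    have h3 : G.dist (P i) (P (j + 1)) ≤ _ := hG.dist_triangle (v := P j)
    omega

/-- Two points at given offsets from the ends of two paths cannot have the same distances
`E₁, …, E₄` to all four path ends, apart from two exceptional positions. Here `Db, Dc` are the
distances between the ends of the same path and `D₁, …, D₄` those between ends of different
paths. -/
lemma branch_distance_contradiction {i i' j j' E₁ E₂ E₃ E₄ Db Dc D₁ D₂ D₃ D₄ : ℕ}
    (h₁ : E₁ = i) (h₃ : E₃ = j) (hD₁ : 0 < D₁) (hD₂ : 0 < D₂) (hD₃ : 0 < D₃) (hD₄ : 0 < D₄)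
    (l₂ : i + Db ≤ E₂ ∨ i' ≤ E₂) (l₃ : i + D₁ ≤ E₃ ∨ i' + D₃ ≤ E₃)
    (l₄ : i + D₂ ≤ E₄ ∨ i' + D₄ ≤ E₄)
    (m₁ : j + D₁ ≤ E₁ ∨ j' + D₂ ≤ E₁) (m₂ : j + D₃ ≤ E₂ ∨ j' + D₄ ≤ E₂)
    (m₄ : j + Dc ≤ E₄ ∨ j' ≤ E₄)
    (u₂ : E₂ ≤ i') (u₃ : E₃ ≤ i + D₁ ∧ E₃ ≤ i' + D₃)
    (w₁ : E₁ ≤ j + D₁ ∧ E₁ ≤ j' + D₂) (w₄ : E₄ ≤ j')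
    (t : D₁ ≤ Dc + D₂)
    (k : 2 * i ≠ i + i' + D₃ + D₁) (n : 2 * j ≠ j + j' + D₂ + D₁) : False := by
  subst h₁ h₃
  rcases m₁ with m₁ | m₁ <;> rcases l₃ with l₃ | l₃
  · omega
  · exact k (by omega)
  · exact n (by omega)
  · clear k n
    have h₂ : E₂ = i' := by omega
    have h₄ : E₄ = j' := by omega
    omega

set_option maxHeartbeats 1000000 in
/-- A connected graph whose vertices lie on `#X` disjoint paths, each with no edge leaving it from
an interior vertex, has a locating set of size at most `6 * #X ^ 2`. -/
lemma SimpleGraph.Connected.exists_isLocatingSet_of_paths {G : SimpleGraph V} (hG : G.Connected)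
    (X : Finset V) (P : V → ℕ → V) (L : V → ℕ) (hP₀ : ∀ b, P b 0 = b)
    (hadj : ∀ b ∈ X, ∀ j < L b, G.Adj (P b j) (P b (j + 1)))
    (hN : ∀ b ∈ X, ∀ j, 0 < j → j < L b → ∀ w, G.Adj (P b j) w →
      w = P b (j - 1) ∨ w = P b (j + 1))
    (hinj : ∀ b ∈ X, ∀ b' ∈ X, ∀ i ≤ L b, ∀ j ≤ L b', P b i = P b' j → b = b' ∧ i = j)
    (hcover : ∀ v, ∃ b ∈ X, ∃ j ≤ L b, P b j = v) :
    ∃ S : Finset V, IsLocatingSet G S ∧ S.card ≤ 6 * X.card ^ 2 := by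
  classical
  let d := G.dist
  let f₁ : V × V → V := fun q ↦ P q.1 ((L q.1 + d (P q.1 (L q.1)) q.2 + d q.1 q.2) / 2)
  let f₂ : V × V → V := fun q ↦ P q.1
    ((L q.1 + d (P q.1 (L q.1)) (P q.2 (L q.2)) + d q.1 (P q.2 (L q.2))) / 2)
  let f₃ : V × V → V := fun q ↦ P q.1
    (L q.1 - (L q.1 + d q.1 q.2 + d (P q.1 (L q.1)) q.2) / 2)
  let f₄ : V × V → V := fun q ↦ P q.1
    (L q.1 - (L q.1 + d q.1 (P q.2 (L q.2)) + d (P q.1 (L q.1)) (P q.2 (L q.2))) / 2)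
  let E := X ∪ X.image fun b ↦ P b (L b)
  let F := (X ×ˢ X).image f₁ ∪ (X ×ˢ X).image f₂ ∪ (X ×ˢ X).image f₃ ∪ (X ×ˢ X).image f₄
  refine ⟨E ∪ F, ?_, ?_⟩
  · intro u v huv
    obtain ⟨b, hb, i, hi, rfl⟩ := hcover u
    obtain ⟨c, hc, j, hj, rfl⟩ := hcover v
    by_contra! hcon
    have hS₀ : ∀ a ∈ X, d (P b i) a = d (P c j) a := fun a ha ↦
      hcon a (by simp [E, ha])
    have hS₁ : ∀ a ∈ X, d (P b i) (P a (L a)) = d (P c j) (P a (L a)) := fun a ha ↦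
      hcon _ (by simp only [E, F, Finset.coe_union, Finset.coe_image]; grind)
    have hF : ∀ a ∈ X, ∀ e ∈ X, f₁ (a, e) ∈ F ∧ f₂ (a, e) ∈ F ∧ f₃ (a, e) ∈ F ∧
        f₄ (a, e) ∈ F := by
      intro a ha e he
      have hm : ∀ f : V × V → V, f (a, e) ∈ (X ×ˢ X).image f := fun f ↦
        Finset.mem_image_of_mem f (Finset.mk_mem_product ha he)
      simp only [F, Finset.mem_union, hm, true_or, or_true, and_self]
    have hself : ∀ x ∈ F, P b i ≠ x ∧ P c j ≠ x := by
      intro x hx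
      have h := hcon x (by
        rw [Finset.coe_union]
        exact .inr hx)
      constructor
      · rintro rfl
        rw [G.dist_self, eq_comm, hG.dist_eq_zero_iff] at h
        exact huv h.symm
      · rintro rfl
        rw [G.dist_self, hG.dist_eq_zero_iff] at h
        exact huv h
    have hlow₀ : ∀ a ∈ X, ∀ e ∈ X, ∀ k ≤ L a, k + d a e ≤ d (P a k) e ∨
        L a - k + d (P a (L a)) e ≤ d (P a k) e := by
      intro a ha e he k hk
      have := hG.le_dist_of_path (hN a ha) (v := e) (fun l hl hlL h ↦ by
        have := (hinj e he a ha 0 (Nat.zero_le _) l hlL.le (by rw [hP₀]; exact h)).2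
        omega) hk
      rwa [hP₀] at this
    have hlow₁ : ∀ a ∈ X, ∀ e ∈ X, ∀ k ≤ L a, k + d a (P e (L e)) ≤ d (P a k) (P e (L e)) ∨
        L a - k + d (P a (L a)) (P e (L e)) ≤ d (P a k) (P e (L e)) := by
      intro a ha e he k hk
      have := hG.le_dist_of_path (hN a ha) (v := P e (L e)) (fun l hl hlL h ↦ by
        obtain ⟨rfl, h⟩ := hinj e he a ha (L e) le_rfl l hlL.le h
        omega) hk
      rwa [hP₀] at this
    have hup : ∀ a ∈ X, ∀ e, ∀ k ≤ L a, d (P a k) e ≤ k + d a e ∧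
        d (P a k) e ≤ L a - k + d (P a (L a)) e := by
      intro a ha e k hk
      have h1 := hG.dist_le_of_chain (hadj a ha) (Nat.zero_le k) hk
      have h2 := hG.dist_le_of_chain (hadj a ha) hk le_rfl
      rw [hP₀, G.dist_comm] at h1
      have h3 : G.dist (P a k) e ≤ _ := hG.dist_triangle (v := a)
      have h4 : G.dist (P a k) e ≤ _ := hG.dist_triangle (v := P a (L a))
      constructor <;> simp only [d] <;> omega
    have e₁ := hS₀ b hb
    have e₂ := hS₁ b hb
    have e₃ := hS₀ c hc
    have e₄ := hS₁ c hc
    have l₁ := hlow₀ b hb b hb i hi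
    have l₂ := hlow₁ b hb b hb i hi
    have l₃ := hlow₀ b hb c hc i hi
    have l₄ := hlow₁ b hb c hc i hi
    have m₁ := hlow₀ c hc b hb j hj
    have m₂ := hlow₁ c hc b hb j hj
    have m₃ := hlow₀ c hc c hc j hj
    have m₄ := hlow₁ c hc c hc j hj
    have u₁ := hup b hb b i hi
    have u₂ := hup b hb (P b (L b)) i hi
    have u₃ := hup b hb c i hi
    have u₄ := hup b hb (P c (L c)) i hi
    have w₁ := hup c hc b j hj
    have w₂ := hup c hc (P b (L b)) j hj
    have w₃ := hup c hc c j hj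
    have w₄ := hup c hc (P c (L c)) j hj
    have zb : d b b = 0 := G.dist_self
    have zc : d c c = 0 := G.dist_self
    have zb' : d (P b (L b)) (P b (L b)) = 0 := G.dist_self
    have zc' : d (P c (L c)) (P c (L c)) = 0 := G.dist_self
    have sb : d (P b (L b)) b = d b (P b (L b)) := G.dist_comm
    have sc : d (P c (L c)) c = d c (P c (L c)) := G.dist_comm
    by_cases hbc : b = c
    · subst hbc
      have hij : i ≠ j := fun h ↦ huv (by rw [h])
      have hD : 0 < L b → 0 < d b (P b (L b)) := fun h ↦ by
        refine hG.pos_dist_of_ne fun h' ↦ ?_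
        have := (hinj b hb b hb 0 (Nat.zero_le _) (L b) le_rfl (by rwa [hP₀])).2
        omega
      clear l₃ l₄ m₃ m₄ u₃ u₄ w₃ w₄ hup hlow₀ hlow₁ hself
      generalize d b (P b (L b)) = D at *
      generalize d (P b i) b = D₁ at *
      generalize d (P b i) (P b (L b)) = D₂ at *
      generalize d (P b j) b = D₃ at *
      generalize d (P b j) (P b (L b)) = D₄ at *
      omega
    · have hne : ∀ i ≤ L b, ∀ j ≤ L c, 0 < d (P b i) (P c j) := fun i hi j hj ↦
        hG.pos_dist_of_ne fun h ↦ hbc (hinj b hb c hc i hi j hj h).1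
      have p₁ := hne 0 (Nat.zero_le _) 0 (Nat.zero_le _)
      have p₂ := hne 0 (Nat.zero_le _) (L c) le_rfl
      have p₃ := hne (L b) le_rfl 0 (Nat.zero_le _)
      have p₄ := hne (L b) le_rfl (L c) le_rfl
      rw [hP₀] at p₁ p₂ p₃
      rw [hP₀] at p₁
      have k₁ : i ≠ (L b + d (P b (L b)) c + d b c) / 2 := fun h ↦
        (hself (f₁ (b, c)) (hF b hb c hc).1).1 (by simp only [f₁]; rw [← h])
      have k₂ : i ≠ (L b + d (P b (L b)) (P c (L c)) + d b (P c (L c))) / 2 := fun h ↦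
        (hself (f₂ (b, c)) (hF b hb c hc).2.1).1 (by simp only [f₂]; rw [← h])
      have k₃ : i ≠ L b - (L b + d b c + d (P b (L b)) c) / 2 := fun h ↦
        (hself (f₃ (b, c)) (hF b hb c hc).2.2.1).1 (by simp only [f₃]; rw [← h])
      have k₄ : i ≠ L b - (L b + d b (P c (L c)) + d (P b (L b)) (P c (L c))) / 2 := fun h ↦
        (hself (f₄ (b, c)) (hF b hb c hc).2.2.2).1 (by simp only [f₄]; rw [← h])
      have n₁ : j ≠ (L c + d (P c (L c)) b + d c b) / 2 := fun h ↦
        (hself (f₁ (c, b)) (hF c hc b hb).1).2 (by simp only [f₁]; rw [← h])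
      have n₂ : j ≠ (L c + d (P c (L c)) (P b (L b)) + d c (P b (L b))) / 2 := fun h ↦
        (hself (f₂ (c, b)) (hF c hc b hb).2.1).2 (by simp only [f₂]; rw [← h])
      have n₃ : j ≠ L c - (L c + d c b + d (P c (L c)) b) / 2 := fun h ↦
        (hself (f₃ (c, b)) (hF c hc b hb).2.2.1).2 (by simp only [f₃]; rw [← h])
      have n₄ : j ≠ L c - (L c + d c (P b (L b)) + d (P c (L c)) (P b (L b))) / 2 := fun h ↦
        (hself (f₄ (c, b)) (hF c hc b hb).2.2.2).2 (by simp only [f₄]; rw [← h])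
      have s₁ : d c b = d b c := G.dist_comm
      have s₂ : d (P c (L c)) b = d b (P c (L c)) := G.dist_comm
      have s₃ : d (P b (L b)) c = d c (P b (L b)) := G.dist_comm
      have s₄ : d (P c (L c)) (P b (L b)) = d (P b (L b)) (P c (L c)) := G.dist_comm
      have t₁ : d c b ≤ d c (P c (L c)) + d (P c (L c)) b := hG.dist_triangle
      have t₂ : d (P c (L c)) b ≤ d (P c (L c)) c + d c b := hG.dist_triangle
      have t₃ : d c (P b (L b)) ≤ d c (P c (L c)) + d (P c (L c)) (P b (L b)) :=
        hG.dist_triangle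
      have t₄ : d (P c (L c)) (P b (L b)) ≤ d (P c (L c)) c + d c (P b (L b)) :=
        hG.dist_triangle
      clear hup hlow₀ hlow₁ hself hne
      rw [← e₁] at m₁ w₁
      rw [← e₂] at m₂ w₂
      rw [← e₃] at m₃ w₃
      rw [← e₄] at m₄ w₄
      simp only [s₁, s₂, s₃, s₄, zb, zc, zb', zc', sb, sc] at *
      generalize d b (P b (L b)) = Db at *
      generalize d c (P c (L c)) = Dc at *
      generalize d b c = D₁ at *
      generalize d b (P c (L c)) = D₂ at *
      generalize d c (P b (L b)) = D₃ at *
      generalize d (P b (L b)) (P c (L c)) = D₄ at *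
      generalize d (P b i) b = E₁ at *
      generalize d (P b i) (P b (L b)) = E₂ at *
      generalize d (P b i) c = E₃ at *
      generalize d (P b i) (P c (L c)) = E₄ at *
      clear e₁ e₂ e₃ e₄
      obtain ⟨i', hi'⟩ := Nat.exists_eq_add_of_le hi
      obtain ⟨j', hj'⟩ := Nat.exists_eq_add_of_le hj
      have hii : L b - i = i' := by omega
      have hjj : L c - j = j' := by omega
      simp only [hii, hjj, add_zero] at *
      have ho₁ : E₁ = i ∨ E₂ = i' := by omega
      have ho₂ : E₃ = j ∨ E₄ = j' := by omega
      rcases ho₁ with ho₁ | ho₁ <;> rcases ho₂ with ho₂ | ho₂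
      · exact branch_distance_contradiction (i' := i') (j' := j') ho₁ ho₂ p₁ p₂ p₃ p₄ l₂ l₃ l₄ m₁ m₂ m₄
          u₂.2 u₃ w₁ w₄.2 t₁ (by omega) (by omega)
      · exact branch_distance_contradiction (i' := i') (j' := j) ho₁ ho₂ p₂ p₁ p₄ p₃ l₂ l₄ l₃
          m₁.symm m₂.symm m₃.symm u₂.2 u₄ w₁.symm w₃.1 t₂ (by omega) (by omega)
      · exact branch_distance_contradiction (i' := i) (j' := j') ho₁ ho₂ p₃ p₄ p₁ p₂ l₁.symm l₃.symm
          l₄.symm m₂ m₁ m₄ u₁.1 u₃.symm w₂ w₄.2 t₃ (by omega) (by omega)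
      · exact branch_distance_contradiction (i' := i) (j' := j) ho₁ ho₂ p₄ p₃ p₂ p₁ l₁.symm l₄.symm
          l₃.symm m₂.symm m₁.symm m₃.symm u₁.1 u₄.symm w₂.symm w₃.1 t₄ (by omega) (by omega)
  · have hc₁ : ∀ f : V × V → V, ((X ×ˢ X).image f).card ≤ X.card ^ 2 := fun f ↦
      Finset.card_image_le.trans (by rw [Finset.card_product, sq])
    have hE : E.card ≤ X.card + X.card :=
      (Finset.card_union_le _ _).trans (Nat.add_le_add_left Finset.card_image_le _)
    have h₁ := hc₁ f₁
    have h₂ := hc₁ f₂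
    have h₃ := hc₁ f₃
    have h₄ := hc₁ f₄
    have hF : F.card ≤ 4 * X.card ^ 2 := by
      have a₁ := Finset.card_union_le ((X ×ˢ X).image f₁) ((X ×ˢ X).image f₂)
      have a₂ := Finset.card_union_le ((X ×ˢ X).image f₁ ∪ (X ×ˢ X).image f₂) ((X ×ˢ X).image f₃)
      have a₃ := Finset.card_union_le
        ((X ×ˢ X).image f₁ ∪ (X ×ˢ X).image f₂ ∪ (X ×ˢ X).image f₃) ((X ×ˢ X).image f₄)
      simp only [F]
      omega
    have := Finset.card_union_le E F
    have : X.card ≤ X.card ^ 2 := Nat.le_self_pow two_ne_zero _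
    omega

/-- The parent function of a tree rooted at `r`. -/
lemma SimpleGraph.IsTree.exists_parent {T : SimpleGraph V} (hT : T.IsTree) (r : V) :
    ∃ π : V → V, (∀ a, a ≠ r → T.Adj a (π a) ∧ T.dist a r = T.dist (π a) r + 1) ∧
      ∀ a b, T.Adj a b → a = π b ∨ b = π a := by
  have hpar : ∀ a, ∃ b, a ≠ r → T.Adj a b ∧ T.dist a r = T.dist b r + 1 := by
    intro a
    by_cases ha : a = r
    · exact ⟨a, fun h ↦ absurd ha h⟩
    obtain ⟨p, hp⟩ := hT.connected.exists_walk_length_eq_dist a r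
    obtain ⟨b, h, q, rfl⟩ := p.exists_eq_cons_of_ne ha
    refine ⟨b, fun _ ↦ ⟨h, ?_⟩⟩
    have h1 := T.dist_le q
    have h2 := hT.dist_eq_dist_add_one_of_adj r h
    rw [T.dist_comm, T.dist_comm (u := r)] at h2
    rw [Walk.length_cons] at hp
    omega
  choose π hπ using hpar
  have huniq : ∀ a b, T.Adj a b → T.dist a r = T.dist b r + 1 → b = π a := by
    intro a b hab h
    have ha : a ≠ r := by
      rintro rfl
      simp at h
    have hpath : ∀ c, T.Adj a c → T.dist a r = T.dist c r + 1 →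
        ∃ p : T.Walk a r, p.IsPath ∧ p.snd = c := by
      intro c hac hc
      obtain ⟨q, hq⟩ := hT.connected.exists_walk_length_eq_dist c r
      exact ⟨.cons hac q, Walk.isPath_of_length_eq_dist _ (by rw [Walk.length_cons]; omega),
        Walk.snd_cons _ _⟩
    obtain ⟨p, hp, rfl⟩ := hpath b hab h
    obtain ⟨q, hq, hq'⟩ := hpath (π a) (hπ a ha).1 (hπ a ha).2
    rw [(hT.existsUnique_path a r).unique hp hq, hq']
  refine ⟨π, hπ, fun a b hab ↦ ?_⟩
  have h := hT.dist_eq_dist_add_one_of_adj r hab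
  rw [T.dist_comm, T.dist_comm (u := r)] at h
  exact h.elim (fun h ↦ .inr (huniq a b hab h)) fun h ↦ .inl (huniq b a hab.symm h)

/-- If a spanning tree of `G` contains all edges of `G` at vertices outside `X`, and those
vertices have degree two, then `G` has a locating set of size at most `6 * #X ^ 2`. -/
lemma SimpleGraph.IsTree.exists_isLocatingSet [Fintype V] {G T : SimpleGraph V} (hT : T.IsTree)
    (hTG : T ≤ G) [DecidableRel T.Adj] {X : Finset V} (hX : X.Nonempty)
    (hGT : ∀ u v, u ∉ X → G.Adj u v → T.Adj u v) (hdeg : ∀ u, u ∉ X → T.degree u = 2) :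
    ∃ S : Finset V, IsLocatingSet G S ∧ S.card ≤ 6 * X.card ^ 2 := by
  classical
  obtain ⟨r, hr⟩ := hX
  obtain ⟨π, hπ, hedge⟩ := hT.exists_parent r
  have hNr : ∀ u, u ∉ X → u ≠ r := fun u hu h ↦ hu (h ▸ hr)
  have hchild : ∀ u, u ∉ X → ∃ c, c ≠ π u ∧ T.Adj u c ∧ π c = u ∧
      ∀ x, T.Adj u x → x = π u ∨ x = c := by
    intro u hu
    obtain ⟨c, hc, hN⟩ := degree_eq_two_neighbors (hdeg u hu) (hπ u (hNr u hu)).1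
    have huc := (hN c).2 (.inr rfl)
    refine ⟨c, hc, huc, ?_, fun x hx ↦ (hN x).1 hx⟩
    rcases hedge u c huc with h | h
    · exact h.symm
    · exact absurd h hc
  have hreach : ∀ n v, T.dist v r = n → ∃ m, π^[m] v ∈ X := by
    intro n
    induction n with
    | zero =>
      intro v hv
      exact ⟨0, by rwa [Function.iterate_zero_apply, hT.connected.dist_eq_zero_iff.1 hv]⟩
    | succ n ih =>
      intro v hv
      have hvr : v ≠ r := by
        rintro rfl
        simp at hv
      obtain ⟨m, hm⟩ := ih (π v) (by have := (hπ v hvr).2; omega)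
      exact ⟨m + 1, hm⟩
  have hex : ∀ b, ∃ m, π^[m + 1] b ∈ X := fun b ↦ hreach _ (π b) rfl
  let L : V → ℕ := fun b ↦ if b = r then 0 else Nat.find (hex b)
  have hLr : ∀ b j, j < L b → b ≠ r := by
    rintro b j hj rfl
    simp [L] at hj
  have hout : ∀ b j, 0 < j → j ≤ L b → π^[j] b ∉ X := by
    intro b j h0 hj
    obtain ⟨j, rfl⟩ := Nat.exists_eq_succ_of_ne_zero h0.ne'
    have hb := hLr b j (by omega)
    simp only [L, if_neg hb] at hj
    exact Nat.find_min (hex b) (by omega)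
  have hner : ∀ b j, j < L b → π^[j] b ≠ r := by
    intro b j hj
    rcases Nat.eq_zero_or_pos j with rfl | h0
    · exact hLr b 0 hj
    · exact hNr _ (hout b j h0 hj.le)
  have hadj : ∀ b j, j < L b → T.Adj (π^[j] b) (π^[j + 1] b) ∧
      T.dist (π^[j] b) r = T.dist (π^[j + 1] b) r + 1 := by
    intro b j hj
    rw [Function.iterate_succ_apply']
    exact hπ _ (hner b j hj)
  have hNbr : ∀ b j, j + 1 ≤ L b → ∀ w, T.Adj (π^[j + 1] b) w →
      w = π^[j] b ∨ w = π (π^[j + 1] b) := by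
    intro b j hj w hw
    have hu := hout b (j + 1) (by omega) hj
    obtain ⟨c, -, -, -, hN⟩ := hchild _ hu
    have h1 := hadj b j (by omega)
    have h2 := (hπ _ (hNr _ hu)).2
    have h3 : π^[j] b ≠ π (π^[j + 1] b) := by
      intro h
      rw [← h] at h2
      omega
    rcases hN _ h1.1.symm with h | h
    · exact absurd h h3
    · rw [h]
      exact (hN w hw).symm
  refine (hT.connected.mono hTG).exists_isLocatingSet_of_paths X (fun b j ↦ π^[j] b) L
    (fun b ↦ rfl) (fun b _ j hj ↦ hTG (hadj b j hj).1) ?_ ?_ ?_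
  · intro b _ j h0 hj w hw
    obtain ⟨j, rfl⟩ := Nat.exists_eq_succ_of_ne_zero h0.ne'
    have := hNbr b j hj.le w (hGT _ _ (hout b _ h0 hj.le) hw)
    rwa [← Function.iterate_succ_apply' π] at this
  · intro b hb b' hb' i
    induction i with
    | zero =>
      intro _ j hj h
      rcases Nat.eq_zero_or_pos j with rfl | h0
      · exact ⟨h, rfl⟩
      · refine absurd hb ?_
        have := hout b' j h0 hj
        rwa [← h] at this
    | succ i ih =>
      intro hi j hj h
      rcases Nat.eq_zero_or_pos j with rfl | h0
      · refine absurd hb' ?_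
        have := hout b (i + 1) (by omega) hi
        rwa [h] at this
      · obtain ⟨j, rfl⟩ := Nat.exists_eq_succ_of_ne_zero h0.ne'
        change π^[i + 1] b = π^[j + 1] b' at h
        have h1 := hadj b' j (by omega)
        rw [← h] at h1
        rcases hNbr b i hi _ h1.1.symm with h' | h'
        · obtain ⟨rfl, rfl⟩ := ih (by omega) j (by omega) h'.symm
          exact ⟨rfl, rfl⟩
        · have h2 := (hπ _ (hNr _ (hout b (i + 1) (by omega) hi))).2
          rw [← h'] at h2
          omega
  · have hdist : ∀ v, T.dist v r < Fintype.card V := by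
      intro v
      obtain ⟨p, hp, hlen⟩ := hT.connected.exists_path_of_dist v r
      rw [← hlen]
      exact hp.length_lt
    suffices H : ∀ n v, T.dist v r + n = Fintype.card V → ∃ b ∈ X, ∃ j ≤ L b, π^[j] b = v from
      fun v ↦ H (Fintype.card V - T.dist v r) v (by have := hdist v; omega)
    intro n
    induction n with
    | zero =>
      intro v hv
      have := hdist v
      omega
    | succ n ih =>
      intro v hv
      by_cases hvX : v ∈ X
      · exact ⟨v, hvX, 0, Nat.zero_le _, rfl⟩
      obtain ⟨c, hcπ, hvc, hc, -⟩ := hchild v hvX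
      have hcr : c ≠ r := by
        rintro rfl
        have := (hπ v (hNr v hvX)).2
        have h := hT.dist_eq_dist_add_one_of_adj c hvc
        rw [T.dist_comm, T.dist_comm (u := c) (v := c), T.dist_self] at h
        have h0 : T.dist (π v) c = 0 := by omega
        exact hcπ (hT.connected.dist_eq_zero_iff.1 h0).symm
      have hd := (hπ c hcr).2
      rw [hc] at hd
      obtain ⟨b, hb, j, hj, rfl⟩ := ih c (by omega)
      refine ⟨b, hb, j + 1, ?_, by rw [Function.iterate_succ_apply', hc]⟩
      have hbr : b ≠ r := by
        rintro rfl
        have : j = 0 := by simpa [L] using hj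
        subst this
        exact hcr rfl
      simp only [L, if_neg hbr] at hj ⊢
      refine Nat.succ_le_of_lt (lt_of_le_of_ne hj fun h ↦ hvX ?_)
      have := Nat.find_spec (hex b)
      rw [← h, Function.iterate_succ_apply', hc] at this
      exact this

open scoped Classical in
/-- A connected graph with at least two vertices has a spanning tree and a set `X` of linearly many
(in the max leaf number) vertices such that all vertices off `X` have tree degree two and lie on
tree edges only. -/
lemma SimpleGraph.Connected.exists_isTree_of_maxLeafNumber [Fintype V] [Nontrivial V]
    {G : SimpleGraph V} (hG : G.Connected) :
    ∃ T ≤ G, T.IsTree ∧ ∃ X : Finset V, X.Nonempty ∧ X.card ≤ 22 * maxLeafNumber G ∧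
      (∀ u v, u ∉ X → G.Adj u v → T.Adj u v) ∧ ∀ u, u ∉ X → T.degree u = 2 := by
  obtain ⟨T, hTG, hT, hmax⟩ := hG.exists_isTree_leafCount_eq
  let Y₀ := Finset.univ.filter fun v ↦ T.degree v ≠ 2
  let Y₁ := Y₀ ∪ Y₀.biUnion fun v ↦ T.neighborFinset v
  let Y₂ := Y₁ ∪ Y₁.biUnion fun v ↦ T.neighborFinset v
  have hY₀ : ∀ u, u ∉ Y₀ → T.degree u = 2 := fun u hu ↦ by simpa [Y₀] using hu
  have hY₁ : ∀ u, u ∉ Y₁ → u ∉ Y₀ ∧ ∀ y, T.Adj u y → y ∉ Y₀ := fun u hu ↦ by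
    simp only [Y₁, Finset.mem_union, Finset.mem_biUnion, mem_neighborFinset, not_or] at hu
    exact ⟨hu.1, fun y hy h ↦ hu.2 ⟨y, h, hy.symm⟩⟩
  have hY₂ : ∀ u, u ∉ Y₂ → u ∉ Y₁ ∧ ∀ y, T.Adj u y → y ∉ Y₁ := fun u hu ↦ by
    simp only [Y₂, Finset.mem_union, Finset.mem_biUnion, mem_neighborFinset, not_or] at hu
    exact ⟨hu.1, fun y hy h ↦ hu.2 ⟨y, h, hy.symm⟩⟩
  refine ⟨T, hTG, hT, Y₂, ?_, ?_, ?_, fun u hu ↦ hY₀ u (hY₁ u (hY₂ u hu).1).1⟩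
  · obtain ⟨r, hr⟩ := hT.exists_vert_degree_one_of_nontrivial
    exact ⟨r, Finset.mem_union_left _ (Finset.mem_union_left _ (by simp [Y₀, hr]))⟩
  · have h₀ := hT.card_degree_ne_two_le
    have h₁ := hT.card_union_neighbors_le Y₀
    have h₂ := hT.card_union_neighbors_le Y₁
    rw [← leafCount_eq, hmax] at h₀ h₁ h₂
    change Y₀.card ≤ _ at h₀
    change Y₁.card ≤ _ at h₁
    change Y₂.card ≤ _ at h₂
    omega
  · intro u v hu huv
    by_contra hnuv
    obtain ⟨H, hHG, hH, hlt⟩ := hT.exists_connected_leafCount_lt hTG huv hnuv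
      (hY₀ u (hY₁ u (hY₂ u hu).1).1) (fun y hy ↦ hY₀ y ((hY₁ u (hY₂ u hu).1).2 y hy))
      (fun y z hy hz ↦ hY₀ z ((hY₁ y ((hY₂ u hu).2 y hy)).2 z hz))
    exact (hmax ▸ hlt).not_ge (hH.leafCount_le_maxLeafNumber hHG)

/-- There is a constant `c > 0` such that every connected finite graph with at
least one edge and max leaf number `ℓ` has metric dimension at most `c * ℓ²`. -/
theorem metricDim_le_maxLeaf_sq :
    ∃ c : ℕ, 0 < c ∧ ∀ (V : Type) [Fintype V] (G : SimpleGraph V),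
      G.Connected → G.edgeSet.Nonempty →
      metricDim G ≤ c * (maxLeafNumber G) ^ 2 := by
  classical
  refine ⟨2904, by norm_num, fun V _ G hG hne ↦ ?_⟩
  obtain ⟨e, he⟩ := hne
  induction e with | _ a b
  have : Nontrivial V := ⟨a, b, G.ne_of_adj he⟩
  obtain ⟨T, hTG, hT, X, hX, hcard, hGT, hdeg⟩ := hG.exists_isTree_of_maxLeafNumber
  obtain ⟨S, hS, hSX⟩ := hT.exists_isLocatingSet hTG hX hGT hdeg
  calc metricDim G ≤ S.card := Nat.sInf_le ⟨S, hS, Set.ncard_coe_finset S⟩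
    _ ≤ 6 * X.card ^ 2 := hSX
    _ ≤ 6 * (22 * maxLeafNumber G) ^ 2 := by gcongr
    _ = 2904 * maxLeafNumber G ^ 2 := by ring
end
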